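/- Fix m ≥ 2 and n ≥ 2, and let T_{n,m} be the number of tiered trees on {1,…,n} with tiering functions valued in {1,…,m} (surjective or not). For i ∈ {1,…,m}, let M_{i,n,m} be the number of pairs (T, r) where T is such a tiered tree and r is a distinguished root vertex of T lying on tier i. Then M_{i,n,m} = (n/m) · T_{n,m}; in particular M_{i,n,m} is independent of i. -/

import Mathlib

open scoped Classical

/-- Reachability along a finite edge set (edges are unordered pairs of naturals). -/
def EReach (E : Finset (Sym2 ℕ)) : ℕ → ℕ → Prop :=
  Relation.ReflTransGen fun a b => s(a, b) ∈ E

/-- `E` is the edge set of a tree on the vertex set `V`: all edges join distinct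
vertices of `V`, any two vertices of `V` are joined by a walk, and the number of
edges is one less than the number of vertices. -/
def IsTreeOn (V : Finset ℕ) (E : Finset (Sym2 ℕ)) : Prop :=
  (∀ e ∈ E, ∀ x ∈ e, x ∈ V) ∧ (∀ e ∈ E, ¬ e.IsDiag) ∧
    (∀ a ∈ V, ∀ b ∈ V, EReach E a b) ∧ E.card + 1 = V.card

/-- `t` is a tiering function (with tiers `1, …, m`) for the graph with vertex set `V`
and edge set `E`: tiers lie in `{1, …, m}` and if `a < b` are adjacent then `t a < t b`. -/
def IsTieredOn (V : Finset ℕ) (E : Finset (Sym2 ℕ)) (m : ℕ) (t : ℕ → ℕ) : Prop :=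
  (∀ v ∈ V, t v ∈ Finset.Icc 1 m) ∧ ∀ a b : ℕ, s(a, b) ∈ E → a < b → t a < t b

/-- Auxiliary fuelled recursion computing the weight of a tiered tree: delete the
minimal vertex `v`, and sum, over the components `C` of the resulting forest
(one for each neighbour `u` of `v`), the weight of the component plus the number
of vertices `x ∈ C` with `t x > t v` and `x < u`.  (Fuel `V.card` always suffices,
since components are strictly smaller.) -/
noncomputable def treeWeightAux (t : ℕ → ℕ) : ℕ → Finset ℕ → Finset (Sym2 ℕ) → ℕ
  | 0, _, _ => 0
  | fuel + 1, V, E =>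
    if h : 2 ≤ V.card then
      let v := V.min' (Finset.card_pos.mp (by omega))
      let E' := E.filter fun e => v ∉ e
      ((V.erase v).filter fun u => s(v, u) ∈ E).sum fun u =>
        let C := (V.erase v).filter fun x => EReach E' u x
        (C.filter fun x => t v < t x ∧ x < u).card +
          treeWeightAux t fuel C (E'.filter fun e => ∀ x ∈ e, x ∈ C)
    else 0

/-- The weight of a tiered tree with vertex set `V`, edge set `E` and tiering function `t`. -/
noncomputable def treeWeight (V : Finset ℕ) (E : Finset (Sym2 ℕ)) (t : ℕ → ℕ) : ℕ :=
  treeWeightAux t V.card V E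

/-- The set of tiered trees on `{1,…,n}` with tiering functions valued in `{1,…,m}`
(surjective or not), encoded as pairs `(E, t)` of an edge set and a tiering function,
normalised to vanish off `{1,…,n}`. -/
def TieredTrees (n m : ℕ) : Set (Finset (Sym2 ℕ) × (ℕ → ℕ)) :=
  {T | IsTreeOn (Finset.Icc 1 n) T.1 ∧ IsTieredOn (Finset.Icc 1 n) T.1 m T.2 ∧
    ∀ x, x ∉ Finset.Icc 1 n → T.2 x = 0}

/-- `T_{n,m}`: the number of tiered trees on `{1,…,n}` with tiers valued in `{1,…,m}`. -/
noncomputable def Tcount (n m : ℕ) : ℕ := Nat.card (TieredTrees n m)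

section

open Finset Polynomial

/-- The comparable pairs of the tiering `t` inside `K`, ordered increasingly. -/
noncomputable def ascentPairs (t : ℕ → ℕ) (K : Finset ℕ) : Finset (ℕ × ℕ) :=
  (K ×ˢ K).filter fun p => p.1 < p.2 ∧ t p.1 < t p.2

/-- The edges on the vertex set `K` that are admissible for the tiering `t`. -/
noncomputable def tierEdges (t : ℕ → ℕ) (K : Finset ℕ) : Finset (Sym2 ℕ) :=
  (ascentPairs t K).image fun p => s(p.1, p.2)

/-- The edge set `S` connects the vertices of `K`. -/
def ConnectsOn (K : Finset ℕ) (S : Finset (Sym2 ℕ)) : Prop :=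
  ∀ a ∈ K, ∀ b ∈ K, EReach S a b

/-- Generating polynomial, by number of edges, of the graphs on `K` compatible with `t`. -/
noncomputable def graphPoly (t : ℕ → ℕ) (K : Finset ℕ) : ℤ[X] :=
  ∑ S ∈ (tierEdges t K).powerset, X ^ S.card

/-- Generating polynomial, by number of edges, of the connected graphs on `K` compatible
with `t`. -/
noncomputable def connPoly (t : ℕ → ℕ) (K : Finset ℕ) : ℤ[X] :=
  ∑ S ∈ (tierEdges t K).powerset.filter (ConnectsOn K), X ^ S.card

/-- The number of vertices of `K` on tier `i` minus the number of those on tier `i + 1`. -/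
noncomputable def tierDiff (i : ℕ) (t : ℕ → ℕ) (K : Finset ℕ) : ℤ :=
  ((K.filter fun x => t x = i).card : ℤ) - (K.filter fun x => t x = i + 1).card

/-- The functions with values in `{1, …, m}` on `V` and vanishing off `V`. -/
noncomputable def tierings (V : Finset ℕ) (m : ℕ) : Finset (ℕ → ℕ) :=
  (V.pi fun _ => Icc 1 m).image fun f x => if h : x ∈ V then f x h else 0

theorem mem_tierings {V : Finset ℕ} {m : ℕ} {t : ℕ → ℕ} :
    t ∈ tierings V m ↔ (∀ v ∈ V, t v ∈ Icc 1 m) ∧ ∀ x, x ∉ V → t x = 0 := by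
  unfold tierings
  rw [Finset.mem_image]
  constructor
  · rintro ⟨f, hf, rfl⟩
    rw [Finset.mem_pi] at hf
    refine ⟨fun v hv => ?_, fun x hx => ?_⟩
    · simpa only [dif_pos hv] using hf v hv
    · simp only [dif_neg hx]
  · rintro ⟨h₁, h₂⟩
    refine ⟨fun x _ => t x, Finset.mem_pi.mpr fun v hv => h₁ v hv, ?_⟩
    funext x
    by_cases hx : x ∈ V
    · simp only [dif_pos hx]
    · simp only [dif_neg hx, h₂ x hx]

theorem mem_ascentPairs {t : ℕ → ℕ} {K : Finset ℕ} {p : ℕ × ℕ} :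
    p ∈ ascentPairs t K ↔ (p.1 ∈ K ∧ p.2 ∈ K) ∧ p.1 < p.2 ∧ t p.1 < t p.2 := by
  simp [ascentPairs]

theorem mk_mem_tierEdges {t : ℕ → ℕ} {K : Finset ℕ} {a b : ℕ} :
    s(a, b) ∈ tierEdges t K ↔
      a ∈ K ∧ b ∈ K ∧ (a < b ∧ t a < t b ∨ b < a ∧ t b < t a) := by
  unfold tierEdges
  simp only [Finset.mem_image, mem_ascentPairs, Prod.exists, Sym2.eq_iff]
  constructor
  · rintro ⟨c, d, h, ⟨rfl, rfl⟩ | ⟨rfl, rfl⟩⟩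
    · exact ⟨h.1.1, h.1.2, Or.inl h.2⟩
    · exact ⟨h.1.2, h.1.1, Or.inr h.2⟩
  · rintro ⟨ha, hb, h | h⟩
    · exact ⟨a, b, ⟨⟨ha, hb⟩, h⟩, Or.inl ⟨rfl, rfl⟩⟩
    · exact ⟨b, a, ⟨⟨hb, ha⟩, h⟩, Or.inr ⟨rfl, rfl⟩⟩

theorem card_tierEdges (t : ℕ → ℕ) (K : Finset ℕ) :
    (tierEdges t K).card = (ascentPairs t K).card := by
  unfold tierEdges
  refine Finset.card_image_of_injOn ?_
  rintro ⟨a, b⟩ h ⟨c, d⟩ h' hh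
  have h₁ := (mem_ascentPairs.mp (Finset.mem_coe.mp h)).2.1
  have h₂ := (mem_ascentPairs.mp (Finset.mem_coe.mp h')).2.1
  simp only [Sym2.eq_iff] at hh h₁ h₂
  rw [Prod.mk.injEq]
  omega

theorem graphPoly_eq_pow (t : ℕ → ℕ) (K : Finset ℕ) :
    graphPoly t K = (X + 1) ^ (ascentPairs t K).card := by
  rw [← card_tierEdges, graphPoly, ← Finset.sum_pow_mul_eq_add_pow]
  simp

theorem EReach.symm {S : Finset (Sym2 ℕ)} {a b : ℕ} (h : EReach S a b) : EReach S b a := by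
  induction h with
  | refl => exact Relation.ReflTransGen.refl
  | tail _ hbc ih => exact Relation.ReflTransGen.head (Sym2.eq_swap ▸ hbc) ih

theorem EReach.mono {S S' : Finset (Sym2 ℕ)} (hS : S ⊆ S') {a b : ℕ} (h : EReach S a b) :
    EReach S' a b := by
  induction h with
  | refl => exact Relation.ReflTransGen.refl
  | tail _ hbc ih => exact Relation.ReflTransGen.tail ih (hS hbc)

theorem tierEdges_congr {t t' : ℕ → ℕ} {K : Finset ℕ} (h : ∀ x ∈ K, t x = t' x) :
    tierEdges t K = tierEdges t' K := by
  ext e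
  induction e using Sym2.ind with
  | _ a b =>
    rw [mk_mem_tierEdges, mk_mem_tierEdges]
    refine and_congr_right fun ha => and_congr_right fun hb => ?_
    rw [h a ha, h b hb]

theorem graphPoly_congr {t t' : ℕ → ℕ} {K : Finset ℕ} (h : ∀ x ∈ K, t x = t' x) :
    graphPoly t K = graphPoly t' K := by
  rw [graphPoly, tierEdges_congr h, graphPoly]

theorem connPoly_congr {t t' : ℕ → ℕ} {K : Finset ℕ} (h : ∀ x ∈ K, t x = t' x) :
    connPoly t K = connPoly t' K := by
  rw [connPoly, tierEdges_congr h, connPoly]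

theorem tierDiff_congr {i : ℕ} {t t' : ℕ → ℕ} {K : Finset ℕ} (h : ∀ x ∈ K, t x = t' x) :
    tierDiff i t K = tierDiff i t' K := by
  rw [tierDiff, tierDiff, Finset.filter_congr fun x hx => by rw [h x hx],
    Finset.filter_congr (p := fun x => t x = i + 1) fun x hx => by rw [h x hx]]

/-- Splitting a graph along the component of a vertex `r`, when that component is `K`. -/
theorem sum_graphs_with_component (t : ℕ → ℕ) {V K : Finset ℕ} (hK : K ⊆ V) {r : ℕ}
    (hr : r ∈ K) :
    ∑ S ∈ (tierEdges t V).powerset.filter (fun S => V.filter (EReach S r) = K),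
        (X : ℤ[X]) ^ S.card = connPoly t K * graphPoly t (V \ K) := by
  rw [connPoly, graphPoly, Finset.sum_mul_sum, ← Finset.sum_product']
  refine Finset.sum_nbij'
    (fun S => (S.filter fun e => ∀ x ∈ e, x ∈ K, S.filter fun e => ∀ x ∈ e, x ∉ K))
    (fun p => p.1 ∪ p.2) ?_ ?_ ?_ ?_ ?_
  · intro S hS
    rw [Finset.mem_filter, Finset.mem_powerset] at hS
    obtain ⟨hSV, hSK⟩ := hS
    have hreach : ∀ x, EReach S r x →
        EReach (S.filter fun e => ∀ x ∈ e, x ∈ K) r x := by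
      intro x hx
      induction hx with
      | refl => exact Relation.ReflTransGen.refl
      | @tail b c hb hbc ih =>
        refine Relation.ReflTransGen.tail ih ?_
        have hm := mk_mem_tierEdges.mp (hSV hbc)
        have hbK : b ∈ K := hSK ▸ Finset.mem_filter.mpr ⟨hm.1, hb⟩
        have hcK : c ∈ K := hSK ▸ Finset.mem_filter.mpr
          ⟨hm.2.1, Relation.ReflTransGen.tail hb hbc⟩
        refine Finset.mem_filter.mpr ⟨hbc, fun x hx => ?_⟩
        rcases Sym2.mem_iff.mp hx with rfl | rfl
        · exact hbK
        · exact hcK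
    have hroot : ∀ x ∈ K, EReach (S.filter fun e => ∀ x ∈ e, x ∈ K) r x := by
      intro x hx
      rw [← hSK, Finset.mem_filter] at hx
      exact hreach x hx.2
    rw [Finset.mem_product, Finset.mem_filter, Finset.mem_powerset, Finset.mem_powerset]
    refine ⟨⟨?_, fun a ha b hb => (hroot a ha).symm.trans (hroot b hb)⟩, ?_⟩
    · intro e he
      rw [Finset.mem_filter] at he
      induction e using Sym2.ind with
      | _ a b =>
        have hm := mk_mem_tierEdges.mp (hSV he.1)
        exact mk_mem_tierEdges.mpr ⟨he.2 a (Sym2.mem_mk_left a b),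
          he.2 b (Sym2.mem_mk_right a b), hm.2.2⟩
    · intro e he
      rw [Finset.mem_filter] at he
      induction e using Sym2.ind with
      | _ a b =>
        have hm := mk_mem_tierEdges.mp (hSV he.1)
        exact mk_mem_tierEdges.mpr
          ⟨Finset.mem_sdiff.mpr ⟨hm.1, he.2 a (Sym2.mem_mk_left a b)⟩,
            Finset.mem_sdiff.mpr ⟨hm.2.1, he.2 b (Sym2.mem_mk_right a b)⟩, hm.2.2⟩
  · rintro ⟨S, S'⟩ h
    simp only [Finset.mem_product, Finset.mem_filter, Finset.mem_powerset] at h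
    obtain ⟨⟨hS, hconn⟩, hS'⟩ := h
    rw [Finset.mem_filter, Finset.mem_powerset]
    constructor
    · intro e he
      induction e using Sym2.ind with
      | _ a b =>
        rcases Finset.mem_union.mp he with he | he
        · have hm := mk_mem_tierEdges.mp (hS he)
          exact mk_mem_tierEdges.mpr ⟨hK hm.1, hK hm.2.1, hm.2.2⟩
        · have hm := mk_mem_tierEdges.mp (hS' he)
          exact mk_mem_tierEdges.mpr
            ⟨(Finset.mem_sdiff.mp hm.1).1, (Finset.mem_sdiff.mp hm.2.1).1, hm.2.2⟩
    · ext x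
      rw [Finset.mem_filter]
      constructor
      · rintro ⟨-, hx⟩
        induction hx with
        | refl => exact hr
        | @tail b c _ hbc ih =>
          rcases Finset.mem_union.mp hbc with he | he
          · exact (mk_mem_tierEdges.mp (hS he)).2.1
          · exact absurd ih (Finset.mem_sdiff.mp (mk_mem_tierEdges.mp (hS' he)).1).2
      · exact fun hx => ⟨hK hx, (hconn r hr x hx).mono Finset.subset_union_left⟩
  · intro S hS
    rw [Finset.mem_filter, Finset.mem_powerset] at hS
    obtain ⟨hSV, hSK⟩ := hS
    ext e
    rw [Finset.mem_union, Finset.mem_filter, Finset.mem_filter]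
    refine ⟨fun h => h.elim And.left And.left, fun he => ?_⟩
    have key : ∀ a b, s(a, b) ∈ S → a ∈ K → b ∈ K := by
      intro a b hab ha
      have hm := mk_mem_tierEdges.mp (hSV hab)
      rw [← hSK, Finset.mem_filter] at ha ⊢
      exact ⟨hm.2.1, Relation.ReflTransGen.tail ha.2 hab⟩
    induction e using Sym2.ind with
    | _ a b =>
      have h₁ := key a b he
      have h₂ := key b a (Sym2.eq_swap ▸ he)
      simp only [Sym2.mem_iff, forall_eq_or_imp, forall_eq]
      tauto
  · rintro ⟨S, S'⟩ h
    simp only [Finset.mem_product, Finset.mem_filter, Finset.mem_powerset] at h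
    obtain ⟨⟨hS, -⟩, hS'⟩ := h
    refine Prod.ext ?_ ?_ <;> ext e <;> induction e using Sym2.ind with
      | _ a b =>
        have h₁ := fun he => mk_mem_tierEdges.mp (@hS s(a, b) he)
        have h₂ := fun he => mk_mem_tierEdges.mp (@hS' s(a, b) he)
        simp only [Finset.mem_sdiff] at h₂
        simp only [Finset.mem_filter, Finset.mem_union, Sym2.mem_iff, forall_eq_or_imp,
          forall_eq]
        tauto
  · intro S hS
    rw [Finset.mem_filter, Finset.mem_powerset] at hS
    obtain ⟨hSV, hSK⟩ := hS
    have key : ∀ a b, s(a, b) ∈ S → a ∈ K → b ∈ K := by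
      intro a b hab ha
      have hm := mk_mem_tierEdges.mp (hSV hab)
      rw [← hSK, Finset.mem_filter] at ha ⊢
      exact ⟨hm.2.1, Relation.ReflTransGen.tail ha.2 hab⟩
    rw [← pow_add, ← Finset.card_filter_add_card_filter_not (s := S) fun e => ∀ x ∈ e, x ∈ K]
    congr 3
    refine Finset.filter_congr fun e he => ?_
    induction e using Sym2.ind with
    | _ a b =>
      have h₁ := key a b he
      have h₂ := key b a (Sym2.eq_swap ▸ he)
      simp only [Sym2.mem_iff, forall_eq_or_imp, forall_eq]
      tauto

theorem graphPoly_eq_sum_component (t : ℕ → ℕ) {V : Finset ℕ} {r : ℕ} (hr : r ∈ V) :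
    graphPoly t V = ∑ K ∈ V.powerset.filter (fun K => r ∈ K),
      connPoly t K * graphPoly t (V \ K) := by
  rw [graphPoly, ← Finset.sum_fiberwise_of_maps_to (g := fun S => V.filter (EReach S r))
    (t := V.powerset.filter (fun K => r ∈ K))]
  · refine Finset.sum_congr rfl fun K hK => ?_
    rw [Finset.mem_filter, Finset.mem_powerset] at hK
    exact sum_graphs_with_component t hK.1 hK.2
  · intro S _
    simp only [Finset.mem_filter, Finset.mem_powerset]
    exact ⟨Finset.filter_subset _ _, hr, Relation.ReflTransGen.refl⟩

theorem tierDiff_eq_sum (i : ℕ) (t : ℕ → ℕ) (K : Finset ℕ) :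
    tierDiff i t K =
      ∑ r ∈ K, ((if t r = i then 1 else 0) - (if t r = i + 1 then 1 else 0) : ℤ) := by
  rw [Finset.sum_sub_distrib, Finset.sum_boole, Finset.sum_boole, tierDiff]

theorem tierDiff_mul_graphPoly (i : ℕ) (t : ℕ → ℕ) (V : Finset ℕ) :
    (tierDiff i t V : ℤ[X]) * graphPoly t V =
      ∑ K ∈ V.powerset, (tierDiff i t K : ℤ[X]) * connPoly t K * graphPoly t (V \ K) := by
  simp only [tierDiff_eq_sum, Int.cast_sum, Finset.sum_mul]
  rw [Finset.sum_congr rfl fun r hr => by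
    rw [graphPoly_eq_sum_component t hr, Finset.mul_sum]]
  rw [Finset.sum_comm' (t' := V.powerset) (s' := fun K => K)]
  · simp only [mul_assoc]
  · intro r K
    simp only [Finset.mem_filter, Finset.mem_powerset]
    exact ⟨fun h => ⟨h.2.2, h.2.1⟩, fun h => ⟨h.2 h.1, h.2, h.1⟩⟩

/-- Summing a product of two functions, one depending on the values in `K` and the other on
the values off `K`, over the tierings. -/
theorem card_mul_sum_tierings {R : Type*} [CommRing R] (V : Finset ℕ) (m : ℕ) (K : Finset ℕ)
    (F G : (ℕ → ℕ) → R) (hF : ∀ t t', (∀ x ∈ K, t x = t' x) → F t = F t')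
    (hG : ∀ t t', (∀ x, x ∉ K → t x = t' x) → G t = G t') :
    ((tierings V m).card : R) * ∑ t ∈ tierings V m, F t * G t =
      (∑ t ∈ tierings V m, F t) * ∑ t ∈ tierings V m, G t := by
  have hmix : ∀ t ∈ tierings V m, ∀ t' ∈ tierings V m, K.piecewise t t' ∈ tierings V m := by
    intro t ht t' ht'
    rw [mem_tierings] at ht ht' ⊢
    refine ⟨fun v hv => ?_, fun x hx => ?_⟩
    · exact Finset.piecewise_cases K t t' (· ∈ Icc 1 m) (ht.1 v hv) (ht'.1 v hv)
    · exact Finset.piecewise_cases K t t' (· = 0) (ht.2 x hx) (ht'.2 x hx)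
  rw [Finset.sum_mul_sum, ← Finset.sum_product', ← nsmul_eq_mul, ← Finset.sum_const,
    ← Finset.sum_product' (tierings V m) (tierings V m) fun t' t => F t * G t]
  have hmaps : ∀ p ∈ tierings V m ×ˢ tierings V m,
      (K.piecewise p.2 p.1, K.piecewise p.1 p.2) ∈ tierings V m ×ˢ tierings V m := by
    intro p hp
    rw [Finset.mem_product] at hp ⊢
    exact ⟨hmix _ hp.2 _ hp.1, hmix _ hp.1 _ hp.2⟩
  have hinv : ∀ t t' : ℕ → ℕ,
      K.piecewise (K.piecewise t t') (K.piecewise t' t) = t := by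
    intro t t'
    funext x
    by_cases h : x ∈ K <;> simp [h]
  refine Finset.sum_nbij' (fun p => (K.piecewise p.2 p.1, K.piecewise p.1 p.2))
    (fun p => (K.piecewise p.2 p.1, K.piecewise p.1 p.2)) hmaps hmaps
    (fun p _ => Prod.ext (hinv _ _) (hinv _ _)) (fun p _ => Prod.ext (hinv _ _) (hinv _ _)) ?_
  intro p _
  rw [hF p.2 (K.piecewise p.2 p.1) fun x hx => (Finset.piecewise_eq_of_mem _ _ _ hx).symm,
    hG p.2 (K.piecewise p.1 p.2) fun x hx => (Finset.piecewise_eq_of_notMem _ _ _ hx).symm]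

theorem exists_reversal (P : Finset ℕ) : ∃ ρ : ℕ → ℕ, (∀ x ∈ P, ρ x ∈ P) ∧
    (∀ x ∈ P, ρ (ρ x) = x) ∧ ∀ x ∈ P, ∀ y ∈ P, x < y → ρ y < ρ x := by
  let e := P.orderIsoOfFin rfl
  refine ⟨fun x => if h : x ∈ P then e (Fin.rev (e.symm ⟨x, h⟩)) else x, ?_, ?_, ?_⟩
  · intro x hx
    simp [hx]
  · intro x hx
    simp [hx]
  · intro x hx y hy hxy
    simp only [hx, hy, dif_pos]
    rw [Subtype.coe_lt_coe, e.lt_iff_lt, Fin.rev_lt_rev, e.symm.lt_iff_lt]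
    exact hxy

/-- The order-reversing involution of a finite set of naturals. -/
noncomputable def reversal (P : Finset ℕ) : ℕ → ℕ := (exists_reversal P).choose

theorem reversal_mem {P : Finset ℕ} {x : ℕ} (hx : x ∈ P) : reversal P x ∈ P :=
  (exists_reversal P).choose_spec.1 x hx

theorem reversal_reversal {P : Finset ℕ} {x : ℕ} (hx : x ∈ P) :
    reversal P (reversal P x) = x :=
  (exists_reversal P).choose_spec.2.1 x hx

theorem reversal_lt {P : Finset ℕ} {x y : ℕ} (hx : x ∈ P) (hy : y ∈ P) (h : x < y) :
    reversal P y < reversal P x :=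
  (exists_reversal P).choose_spec.2.2 x hx y hy h

/-- The vertices of `K` lying on tier `i` or `i + 1`. -/
noncomputable def twoTiers (i : ℕ) (K : Finset ℕ) (t : ℕ → ℕ) : Finset ℕ :=
  K.filter fun x => t x = i ∨ t x = i + 1

/-- Reverse the order of the vertices of `K` on the tiers `i` and `i + 1`, and exchange these
two tiers. -/
noncomputable def swapTiers (i : ℕ) (K : Finset ℕ) (t : ℕ → ℕ) (x : ℕ) : ℕ :=
  if x ∈ twoTiers i K t then 2 * i + 1 - t (reversal (twoTiers i K t) x) else t x

theorem mem_twoTiers {i : ℕ} {K : Finset ℕ} {t : ℕ → ℕ} {x : ℕ} :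
    x ∈ twoTiers i K t ↔ x ∈ K ∧ (t x = i ∨ t x = i + 1) := by
  simp [twoTiers]

theorem swapTiers_of_notMem {i : ℕ} {K : Finset ℕ} {t : ℕ → ℕ} {x : ℕ}
    (h : x ∉ twoTiers i K t) : swapTiers i K t x = t x := by
  simp [swapTiers, h]

theorem swapTiers_of_mem {i : ℕ} {K : Finset ℕ} {t : ℕ → ℕ} {x : ℕ}
    (h : x ∈ twoTiers i K t) :
    swapTiers i K t x = 2 * i + 1 - t (reversal (twoTiers i K t) x) := by
  simp [swapTiers, h]

theorem swapTiers_eq_or {i : ℕ} {K : Finset ℕ} {t : ℕ → ℕ} {x : ℕ}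
    (h : x ∈ twoTiers i K t) : swapTiers i K t x = i ∨ swapTiers i K t x = i + 1 := by
  rw [swapTiers_of_mem h]
  have := (mem_twoTiers.mp (reversal_mem h)).2
  omega

theorem twoTiers_swapTiers (i : ℕ) (K : Finset ℕ) (t : ℕ → ℕ) :
    twoTiers i K (swapTiers i K t) = twoTiers i K t := by
  ext x
  by_cases h : x ∈ twoTiers i K t
  · exact iff_of_true (mem_twoTiers.mpr ⟨(mem_twoTiers.mp h).1, swapTiers_eq_or h⟩) h
  · rw [mem_twoTiers, swapTiers_of_notMem h, ← mem_twoTiers]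

theorem swapTiers_swapTiers (i : ℕ) (K : Finset ℕ) (t : ℕ → ℕ) :
    swapTiers i K (swapTiers i K t) = t := by
  funext x
  by_cases h : x ∈ twoTiers i K t
  · rw [swapTiers_of_mem (by rwa [twoTiers_swapTiers]), twoTiers_swapTiers,
      swapTiers_of_mem (reversal_mem h), reversal_reversal h]
    have := (mem_twoTiers.mp h).2
    omega
  · rw [swapTiers_of_notMem (by rwa [twoTiers_swapTiers]), swapTiers_of_notMem h]

theorem swapTiers_mem_tierings {i m : ℕ} (hi : 1 ≤ i) (him : i + 1 ≤ m) {V K : Finset ℕ}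
    (hK : K ⊆ V) {t : ℕ → ℕ} (ht : t ∈ tierings V m) : swapTiers i K t ∈ tierings V m := by
  rw [mem_tierings] at ht ⊢
  refine ⟨fun v hv => ?_, fun x hx => ?_⟩
  · by_cases h : v ∈ twoTiers i K t
    · have := swapTiers_eq_or h
      rw [Finset.mem_Icc]
      omega
    · rw [swapTiers_of_notMem h]
      exact ht.1 v hv
  · rw [swapTiers_of_notMem fun h => hx (hK (mem_twoTiers.mp h).1)]
    exact ht.2 x hx

theorem card_ascentPairs_le_swapTiers (i : ℕ) (K : Finset ℕ) (t : ℕ → ℕ) :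
    (ascentPairs t K).card ≤ (ascentPairs (swapTiers i K t) K).card := by
  set P := twoTiers i K t with hP
  refine Finset.card_le_card_of_injOn
    (fun p => if p.1 ∈ P ∧ p.2 ∈ P then (reversal P p.2, reversal P p.1) else p) ?_ ?_
  · rintro ⟨a, b⟩ h
    obtain ⟨⟨ha, hb⟩, hab, htab⟩ := mem_ascentPairs.mp (Finset.mem_coe.mp h)
    rw [Finset.mem_coe, mem_ascentPairs]
    simp only at ha hb hab htab ⊢
    split_ifs with hp
    · obtain ⟨haP, hbP⟩ := hp
      refine ⟨⟨(mem_twoTiers.mp (reversal_mem hbP)).1, (mem_twoTiers.mp (reversal_mem haP)).1⟩,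
        reversal_lt haP hbP hab, ?_⟩
      simp only
      rw [swapTiers_of_mem (reversal_mem hbP), swapTiers_of_mem (reversal_mem haP), ← hP,
        reversal_reversal haP, reversal_reversal hbP]
      have h₁ := (mem_twoTiers.mp haP).2
      have h₂ := (mem_twoTiers.mp hbP).2
      omega
    · refine ⟨⟨ha, hb⟩, hab, ?_⟩
      simp only
      by_cases haP : a ∈ P
      · have hbP : b ∉ P := fun h => hp ⟨haP, h⟩
        have h₁ := swapTiers_eq_or haP
        have h₂ := (mem_twoTiers.mp haP).2
        have h₃ : ¬ (t b = i ∨ t b = i + 1) := fun h => hbP (mem_twoTiers.mpr ⟨hb, h⟩)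
        rw [swapTiers_of_notMem hbP]
        omega
      · rw [swapTiers_of_notMem haP]
        by_cases hbP : b ∈ P
        · have h₁ := swapTiers_eq_or hbP
          have h₂ := (mem_twoTiers.mp hbP).2
          have h₃ : ¬ (t a = i ∨ t a = i + 1) := fun h => haP (mem_twoTiers.mpr ⟨ha, h⟩)
          omega
        · rwa [swapTiers_of_notMem hbP]
  · rintro ⟨a, b⟩ - ⟨c, d⟩ - h
    simp only at h
    split_ifs at h with h₁ h₂ h₂
    · rw [Prod.mk.injEq] at h ⊢
      rw [← reversal_reversal h₁.1, ← reversal_reversal h₁.2, h.1, h.2,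
        reversal_reversal h₂.1, reversal_reversal h₂.2]
      exact ⟨rfl, rfl⟩
    · rw [Prod.mk.injEq] at h
      exact absurd ⟨h.1 ▸ reversal_mem h₁.2, h.2 ▸ reversal_mem h₁.1⟩ h₂
    · rw [Prod.mk.injEq] at h
      exact absurd ⟨h.1 ▸ reversal_mem h₂.2, h.2 ▸ reversal_mem h₂.1⟩ h₁
    · exact h

theorem card_ascentPairs_swapTiers (i : ℕ) (K : Finset ℕ) (t : ℕ → ℕ) :
    (ascentPairs (swapTiers i K t) K).card = (ascentPairs t K).card := by
  refine le_antisymm ?_ (card_ascentPairs_le_swapTiers i K t)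
  simpa only [swapTiers_swapTiers] using card_ascentPairs_le_swapTiers i K (swapTiers i K t)

theorem card_tier_swapTiers (i : ℕ) (K : Finset ℕ) (t : ℕ → ℕ) :
    (K.filter fun x => swapTiers i K t x = i).card = (K.filter fun x => t x = i + 1).card := by
  have key : ∀ x ∈ twoTiers i K t, reversal (twoTiers i K t) x ∈ K :=
    fun x hx => (mem_twoTiers.mp (reversal_mem hx)).1
  refine Finset.card_nbij' (reversal (twoTiers i K t)) (reversal (twoTiers i K t)) ?_ ?_ ?_ ?_
  · intro x hx
    simp only [Finset.coe_filter, Set.mem_ofPred_eq] at hx ⊢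
    have hxP : x ∈ twoTiers i K t := by
      rw [← twoTiers_swapTiers]
      exact mem_twoTiers.mpr ⟨hx.1, Or.inl hx.2⟩
    have h := hx.2
    have h' := (mem_twoTiers.mp (reversal_mem hxP)).2
    rw [swapTiers_of_mem hxP] at h
    exact ⟨key x hxP, by omega⟩
  · intro x hx
    simp only [Finset.coe_filter, Set.mem_ofPred_eq] at hx ⊢
    have hxP : x ∈ twoTiers i K t := mem_twoTiers.mpr ⟨hx.1, Or.inr hx.2⟩
    refine ⟨key x hxP, ?_⟩
    rw [swapTiers_of_mem (reversal_mem hxP), reversal_reversal hxP, hx.2]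
    omega
  · intro x hx
    simp only [Finset.coe_filter, Set.mem_ofPred_eq] at hx
    refine reversal_reversal ?_
    rw [← twoTiers_swapTiers]
    exact mem_twoTiers.mpr ⟨hx.1, Or.inl hx.2⟩
  · intro x hx
    simp only [Finset.coe_filter, Set.mem_ofPred_eq] at hx
    exact reversal_reversal (mem_twoTiers.mpr ⟨hx.1, Or.inr hx.2⟩)

theorem tierDiff_swapTiers (i : ℕ) (K : Finset ℕ) (t : ℕ → ℕ) :
    tierDiff i (swapTiers i K t) K = -tierDiff i t K := by
  have h := card_tier_swapTiers i K (swapTiers i K t)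
  rw [swapTiers_swapTiers] at h
  rw [tierDiff, tierDiff, card_tier_swapTiers, ← h]
  ring

theorem sum_tierDiff_mul_graphPoly {i m : ℕ} (hi : 1 ≤ i) (him : i + 1 ≤ m)
    {V K : Finset ℕ} (hK : K ⊆ V) :
    ∑ t ∈ tierings V m, (tierDiff i t K : ℤ[X]) * graphPoly t K = 0 := by
  refine self_eq_neg.mp ?_
  rw [← Finset.sum_neg_distrib]
  refine Finset.sum_nbij' (swapTiers i K) (swapTiers i K)
    (fun t => swapTiers_mem_tierings hi him hK) (fun t => swapTiers_mem_tierings hi him hK)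
    (fun t _ => swapTiers_swapTiers i K t) (fun t _ => swapTiers_swapTiers i K t) ?_
  intro t _
  rw [tierDiff_swapTiers, graphPoly_eq_pow, graphPoly_eq_pow, card_ascentPairs_swapTiers]
  push_cast
  ring

theorem sum_tierDiff_mul_connPoly {i m : ℕ} (hi : 1 ≤ i) (him : i + 1 ≤ m)
    {V K : Finset ℕ} (hK : K ⊆ V) :
    ∑ t ∈ tierings V m, (tierDiff i t K : ℤ[X]) * connPoly t K = 0 := by
  induction K using Finset.strongInduction with
  | H K ih =>
    have hcard : ((tierings V m).card : ℤ[X]) ≠ 0 := by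
      rw [Nat.cast_ne_zero, Finset.card_ne_zero]
      refine ⟨fun x => if x ∈ V then 1 else 0, mem_tierings.mpr ⟨fun v hv => ?_, fun x hx => ?_⟩⟩
      · simp only [hv, if_true, Finset.mem_Icc]
        omega
      · simp only [hx, if_false]
    have h := sum_tierDiff_mul_graphPoly hi him hK
    simp only [tierDiff_mul_graphPoly] at h
    rw [Finset.sum_comm, Finset.sum_eq_single K] at h
    · simpa [graphPoly, tierEdges, ascentPairs] using h
    · intro L hL hLK
      rw [Finset.mem_powerset] at hL
      have hsum := card_mul_sum_tierings V m L
        (fun t => (tierDiff i t L : ℤ[X]) * connPoly t L) (fun t => graphPoly t (K \ L))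
        (fun t t' h => by rw [tierDiff_congr h, connPoly_congr h])
        (fun t t' h => graphPoly_congr fun x hx => h x (Finset.mem_sdiff.mp hx).2)
      rw [ih L (hL.ssubset_of_ne hLK) (hL.trans hK), zero_mul] at hsum
      exact (mul_eq_zero.mp hsum).resolve_left hcard
    · exact fun h => absurd (Finset.mem_powerset_self K) h

/-- The edge sets of the trees on `V` compatible with the tiering `t`. -/
noncomputable def tierTrees (V : Finset ℕ) (t : ℕ → ℕ) : Finset (Finset (Sym2 ℕ)) :=
  (tierEdges t V).powerset.filter fun S => ConnectsOn V S ∧ S.card + 1 = V.card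

theorem coeff_connPoly (t : ℕ → ℕ) {V : Finset ℕ} (hV : V.Nonempty) :
    (connPoly t V).coeff (V.card - 1) = (tierTrees V t).card := by
  have := hV.card_pos
  rw [connPoly, Polynomial.finsetSum_coeff]
  simp only [Polynomial.coeff_X_pow]
  rw [Finset.sum_boole, Finset.filter_filter, tierTrees]
  congr 2
  refine Finset.filter_congr fun S _ => and_congr_right fun _ => ?_
  omega

theorem mem_tierTrees_iff {V : Finset ℕ} {m : ℕ} {t : ℕ → ℕ} {E : Finset (Sym2 ℕ)} :
    t ∈ tierings V m ∧ E ∈ tierTrees V t ↔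
      IsTreeOn V E ∧ IsTieredOn V E m t ∧ ∀ x, x ∉ V → t x = 0 := by
  rw [mem_tierings, tierTrees, Finset.mem_filter, Finset.mem_powerset]
  constructor
  · rintro ⟨⟨h₁, h₂⟩, hE, hc, hcard⟩
    refine ⟨⟨?_, ?_, hc, hcard⟩, ⟨h₁, ?_⟩, h₂⟩
    · intro e he x hx
      induction e using Sym2.ind with
      | _ a b =>
        have hm := mk_mem_tierEdges.mp (hE he)
        rcases Sym2.mem_iff.mp hx with rfl | rfl
        · exact hm.1
        · exact hm.2.1
    · intro e he
      induction e using Sym2.ind with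
      | _ a b =>
        have hm := mk_mem_tierEdges.mp (hE he)
        rw [Sym2.mk_isDiag_iff]
        omega
    · intro a b he hab
      have hm := mk_mem_tierEdges.mp (hE he)
      omega
  · rintro ⟨⟨hV, hd, hc, hcard⟩, ⟨h₁, ht⟩, h₂⟩
    refine ⟨⟨h₁, h₂⟩, fun e he => ?_, hc, hcard⟩
    induction e using Sym2.ind with
    | _ a b =>
      refine mk_mem_tierEdges.mpr ⟨hV _ he a (Sym2.mem_mk_left a b),
        hV _ he b (Sym2.mem_mk_right a b), ?_⟩
      have hne : a ≠ b := fun h => hd _ he (Sym2.mk_isDiag_iff.mpr h)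
      rcases hne.lt_or_gt with hlt | hlt
      · exact Or.inl ⟨hlt, ht a b he hlt⟩
      · exact Or.inr ⟨hlt, ht b a (Sym2.eq_swap ▸ he) hlt⟩

theorem Tcount_eq_sum (n m : ℕ) :
    Tcount n m = ∑ t ∈ tierings (Icc 1 n) m, (tierTrees (Icc 1 n) t).card := by
  let e : TieredTrees n m ≃ (tierings (Icc 1 n) m).sigma fun t => tierTrees (Icc 1 n) t :=
    { toFun := fun T => ⟨⟨T.1.2, T.1.1⟩,
        Finset.mem_sigma.mpr (mem_tierTrees_iff.mpr T.2)⟩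
      invFun := fun p => ⟨(p.1.2, p.1.1), mem_tierTrees_iff.mp (Finset.mem_sigma.mp p.2)⟩
      left_inv := fun _ => rfl
      right_inv := fun _ => rfl }
  rw [Tcount, Nat.card_congr e, Nat.card_eq_fintype_card, Fintype.card_coe, Finset.card_sigma]

theorem card_rooted_eq_sum (n m i : ℕ) :
    Nat.card {Tr : (Finset (Sym2 ℕ) × (ℕ → ℕ)) × ℕ |
        Tr.1 ∈ TieredTrees n m ∧ Tr.2 ∈ Finset.Icc 1 n ∧ Tr.1.2 Tr.2 = i} =
      ∑ t ∈ tierings (Icc 1 n) m,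
        ((Icc 1 n).filter fun r => t r = i).card * (tierTrees (Icc 1 n) t).card := by
  let e : {Tr : (Finset (Sym2 ℕ) × (ℕ → ℕ)) × ℕ |
        Tr.1 ∈ TieredTrees n m ∧ Tr.2 ∈ Finset.Icc 1 n ∧ Tr.1.2 Tr.2 = i} ≃
      (tierings (Icc 1 n) m).sigma fun t =>
        ((Icc 1 n).filter fun r => t r = i) ×ˢ tierTrees (Icc 1 n) t :=
    { toFun := fun T => ⟨⟨T.1.1.2, (T.1.2, T.1.1.1)⟩, by
        have h := mem_tierTrees_iff.mpr T.2.1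
        exact Finset.mem_sigma.mpr ⟨h.1, Finset.mem_product.mpr
          ⟨Finset.mem_filter.mpr T.2.2, h.2⟩⟩⟩
      invFun := fun p => ⟨((p.1.2.2, p.1.1), p.1.2.1), by
        have h := Finset.mem_sigma.mp p.2
        have h' := Finset.mem_product.mp h.2
        exact ⟨mem_tierTrees_iff.mp ⟨h.1, h'.2⟩, Finset.mem_filter.mp h'.1⟩⟩
      left_inv := fun _ => rfl
      right_inv := fun _ => rfl }
  rw [Nat.card_congr e, Nat.card_eq_fintype_card, Fintype.card_coe, Finset.card_sigma]
  simp only [Finset.card_product]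

theorem sum_tier_card_succ {i m : ℕ} (hi : 1 ≤ i) (him : i + 1 ≤ m) {V : Finset ℕ}
    (hV : V.Nonempty) :
    ∑ t ∈ tierings V m, (V.filter fun r => t r = i + 1).card * (tierTrees V t).card =
      ∑ t ∈ tierings V m, (V.filter fun r => t r = i).card * (tierTrees V t).card := by
  have h := congrArg (fun p => p.coeff (V.card - 1))
    (sum_tierDiff_mul_connPoly hi him (Finset.Subset.refl V))
  simp only [Polynomial.finsetSum_coeff, Polynomial.coeff_intCast_mul, coeff_connPoly _ hV,
    tierDiff, sub_mul, Finset.sum_sub_distrib, Polynomial.coeff_zero, Int.cast_id] at h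
  have h' := (sub_eq_zero.mp h).symm
  exact_mod_cast h'

theorem sum_tier_card_eq {i m : ℕ} (hi : i ∈ Icc 1 m) {V : Finset ℕ} (hV : V.Nonempty) :
    ∑ t ∈ tierings V m, (V.filter fun r => t r = i).card * (tierTrees V t).card =
      ∑ t ∈ tierings V m, (V.filter fun r => t r = 1).card * (tierTrees V t).card := by
  rw [Finset.mem_Icc] at hi
  obtain ⟨h₁, h₂⟩ := hi
  induction i, h₁ using Nat.le_induction with
  | base => rfl
  | succ i hi ih => rw [sum_tier_card_succ hi h₂ hV, ih (by omega)]

theorem sum_card_tier {V : Finset ℕ} {m : ℕ} {t : ℕ → ℕ} (ht : t ∈ tierings V m) :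
    ∑ i ∈ Icc 1 m, (V.filter fun r => t r = i).card = V.card :=
  (Finset.card_eq_sum_card_fiberwise (mem_tierings.mp ht).1).symm

end

/-- For `m ≥ 2`, `n ≥ 2` and `i ∈ {1,…,m}`, the number `M_{i,n,m}` of
rooted tiered trees on `{1,…,n}` (tiers valued in `{1,…,m}`) whose root lies on tier `i`
satisfies `M_{i,n,m} = (n/m) · T_{n,m}`, i.e. `m · M_{i,n,m} = n · T_{n,m}`; in
particular `M_{i,n,m}` is independent of `i`. -/
theorem rooted_tiered_tree_count
    (n m : ℕ) (hn : 2 ≤ n) (hm : 2 ≤ m) (i : ℕ) (hi : i ∈ Finset.Icc 1 m) :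
    m * Nat.card {Tr : (Finset (Sym2 ℕ) × (ℕ → ℕ)) × ℕ |
        Tr.1 ∈ TieredTrees n m ∧ Tr.2 ∈ Finset.Icc 1 n ∧ Tr.1.2 Tr.2 = i}
      = n * Tcount n m := by
  have hV : (Finset.Icc 1 n).Nonempty := Finset.nonempty_Icc.mpr (by omega)
  have h := fun j (hj : j ∈ Finset.Icc 1 m) =>
    (sum_tier_card_eq hj hV).trans (sum_tier_card_eq hi hV).symm
  rw [card_rooted_eq_sum, Tcount_eq_sum]
  have hsum := Finset.sum_congr rfl h
  rw [Finset.sum_const, Nat.card_Icc, Nat.add_sub_cancel, smul_eq_mul, Finset.sum_comm] at hsum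
  rw [← hsum, Finset.mul_sum]
  refine Finset.sum_congr rfl fun t ht => ?_
  rw [← Finset.sum_mul, sum_card_tier ht, Nat.card_Icc, Nat.add_sub_cancel]
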